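/- arXiv:2603.27718 — 3 statements merged into one kernel-verified Lean document; each statement's English description precedes it below -/
import Mathlib

section
/- Fix ψ* > 0 and ς > 0, and for ψ₀ > 0 define m(ψ₀) = ∫₀¹ ψ* u^{ς−1} / (ψ₀^ς (1 − u)^ς + ψ* u^ς) du. Then m is strictly decreasing on (0, ∞), and there exists a unique ψ₀ > 0 with m(ψ₀) = 1. -/
open MeasureTheory Set Real

/-- The integrand of `E[-log U]`, with `a = ψ₀ ^ s` as a parameter. -/
noncomputable def weibullIntegrand (c s a u : ℝ) : ℝ :=
  c * u ^ (s - 1) / (a * (1 - u) ^ s + c * u ^ s)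

section weibullIntegrand

variable {c s a b u : ℝ}

lemma weibullIntegrand_denom_pos (hc : 0 < c) (hs : 0 < s) (ha : 0 < a) (hu : u ∈ Icc (0 : ℝ) 1) :
    0 < a * (1 - u) ^ s + c * u ^ s := by
  obtain ⟨h0, h1⟩ := hu
  have h1u : 0 ≤ (1 - u) ^ s := rpow_nonneg (by linarith) s
  rcases h0.eq_or_lt with rfl | h
  · simp [hs.ne', ha]
  · have := rpow_pos_of_pos h s
    positivity

lemma weibullIntegrand_nonneg (hc : 0 < c) (hs : 0 < s) (ha : 0 < a) (hu : u ∈ Icc (0 : ℝ) 1) :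
    0 ≤ weibullIntegrand c s a u :=
  div_nonneg (mul_nonneg hc.le (rpow_nonneg hu.1 _)) (weibullIntegrand_denom_pos hc hs ha hu).le

lemma weibullIntegrand_anti (hc : 0 < c) (hs : 0 < s) (ha : 0 < a) (hab : a ≤ b)
    (hu : u ∈ Icc (0 : ℝ) 1) : weibullIntegrand c s b u ≤ weibullIntegrand c s a u := by
  refine div_le_div_of_nonneg_left (mul_nonneg hc.le (rpow_nonneg hu.1 _))
    (weibullIntegrand_denom_pos hc hs ha hu) ?_
  have : 0 ≤ (1 - u) ^ s := rpow_nonneg (by linarith [hu.2]) s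
  gcongr

lemma weibullIntegrand_strictAnti (hc : 0 < c) (hs : 0 < s) (ha : 0 < a) (hab : a < b)
    (hu : u ∈ Ioo (0 : ℝ) 1) : weibullIntegrand c s b u < weibullIntegrand c s a u := by
  refine div_lt_div_of_pos_left (mul_pos hc (rpow_pos_of_pos hu.1 _))
    (weibullIntegrand_denom_pos hc hs ha (Ioo_subset_Icc_self hu)) ?_
  have : 0 < (1 - u) ^ s := rpow_pos_of_pos (by linarith [hu.2]) s
  gcongr

lemma intervalIntegrable_weibullIntegrand (hc : 0 < c) (hs : 0 < s) (ha : 0 < a) :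
    IntervalIntegrable (weibullIntegrand c s a) volume 0 1 := by
  have h1 : IntervalIntegrable (fun u : ℝ => u ^ (s - 1)) volume 0 1 :=
    intervalIntegral.intervalIntegrable_rpow' (by linarith)
  have h2 : ContinuousOn (fun u : ℝ => c / (a * (1 - u) ^ s + c * u ^ s)) (uIcc 0 1) := by
    rw [uIcc_of_le zero_le_one]
    refine ContinuousOn.div continuousOn_const (Continuous.continuousOn ?_)
      fun u hu => (weibullIntegrand_denom_pos hc hs ha hu).ne'
    have h3 : Continuous fun u : ℝ => (1 - u) ^ s :=
      (continuous_const.sub continuous_id).rpow_const fun _ => Or.inr hs.le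
    have h4 : Continuous fun u : ℝ => u ^ s := continuous_id.rpow_const fun _ => Or.inr hs.le
    exact (h3.const_mul a).add (h4.const_mul c)
  refine (h1.mul_continuousOn h2).congr fun u _ => ?_
  simp only [weibullIntegrand]
  ring

lemma uIoc_zero_one_subset_Icc : uIoc (0 : ℝ) 1 ⊆ Icc 0 1 := by
  rw [uIoc_of_le zero_le_one]
  exact Ioc_subset_Icc_self

lemma norm_weibullIntegrand_le (hc : 0 < c) (hs : 0 < s) (ha : 0 < a) (hab : a ≤ b)
    (hu : u ∈ uIoc (0 : ℝ) 1) : ‖weibullIntegrand c s b u‖ ≤ weibullIntegrand c s a u := by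
  have hu' := uIoc_zero_one_subset_Icc hu
  rw [norm_of_nonneg (weibullIntegrand_nonneg hc hs (ha.trans_le hab) hu')]
  exact weibullIntegrand_anti hc hs ha hab hu'

lemma strictAntiOn_integral_weibullIntegrand (hc : 0 < c) (hs : 0 < s) :
    StrictAntiOn (fun a => ∫ u in (0 : ℝ)..1, weibullIntegrand c s a u) (Ioi 0) := by
  intro a ha b hb hab
  have ia := intervalIntegrable_weibullIntegrand hc hs ha
  have ib := intervalIntegrable_weibullIntegrand hc hs hb
  have := intervalIntegral.intervalIntegral_pos_of_pos_on (ia.sub ib)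
    (fun u hu => sub_pos.2 (weibullIntegrand_strictAnti hc hs ha hab hu)) zero_lt_one
  rw [intervalIntegral.integral_sub ia ib] at this
  exact sub_pos.1 this

lemma continuousOn_integral_weibullIntegrand (hc : 0 < c) (hs : 0 < s) :
    ContinuousOn (fun a => ∫ u in (0 : ℝ)..1, weibullIntegrand c s a u) (Ioi 0) := by
  intro a ha
  have ha : 0 < a := ha
  have hnear : ∀ᶠ b in nhds a, a / 2 < b := lt_mem_nhds (half_lt_self ha)
  refine (intervalIntegral.continuousAt_of_dominated_interval
    (bound := weibullIntegrand c s (a / 2)) ?_ ?_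
    (intervalIntegrable_weibullIntegrand hc hs (half_pos ha)) ?_).continuousWithinAt
  · filter_upwards [hnear] with b hb
    exact (intervalIntegrable_weibullIntegrand hc hs
      ((half_pos ha).trans hb)).aestronglyMeasurable_restrict_uIoc
  · filter_upwards [hnear] with b hb
    exact ae_of_all _ fun u hu => norm_weibullIntegrand_le hc hs (half_pos ha) hb.le hu
  · refine ae_of_all _ fun u hu => ContinuousAt.div continuousAt_const (by fun_prop) ?_
    exact (weibullIntegrand_denom_pos hc hs ha (uIoc_zero_one_subset_Icc hu)).ne'

lemma tendsto_integral_weibullIntegrand_atTop (hc : 0 < c) (hs : 0 < s) :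
    Filter.Tendsto (fun a => ∫ u in (0 : ℝ)..1, weibullIntegrand c s a u) Filter.atTop
      (nhds 0) := by
  have key := intervalIntegral.tendsto_integral_filter_of_dominated_convergence (a := 0) (b := 1)
    (μ := volume) (l := Filter.atTop) (F := weibullIntegrand c s) (f := fun _ => 0)
    (weibullIntegrand c s 1) ?_ ?_ (intervalIntegrable_weibullIntegrand hc hs one_pos) ?_
  · simpa using key
  · filter_upwards [Filter.eventually_ge_atTop 1] with b hb
    exact (intervalIntegrable_weibullIntegrand hc hs
      (one_pos.trans_le hb)).aestronglyMeasurable_restrict_uIoc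
  · filter_upwards [Filter.eventually_ge_atTop 1] with b hb
    exact ae_of_all _ fun u hu => norm_weibullIntegrand_le hc hs one_pos hb hu
  · have hne : ∀ᵐ u : ℝ, u ≠ 1 := by simp [ae_iff]
    filter_upwards [hne] with u hu1 hu
    have hlt : 0 < 1 - u := sub_pos.2 ((uIoc_zero_one_subset_Icc hu).2.lt_of_ne hu1)
    exact Filter.Tendsto.div_atTop tendsto_const_nhds (Filter.tendsto_atTop_add_const_right _ _
      (Filter.tendsto_id.atTop_mul_const (rpow_pos_of_pos hlt s)))

lemma one_le_integral_weibullIntegrand (hc : 0 < c) (hs : 0 < s) :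
    1 ≤ ∫ u in (0 : ℝ)..1, weibullIntegrand c s (c * exp (-2) ^ s) u := by
  set d := exp (-2) with hd
  have hd0 : 0 < d := exp_pos _
  have hd1 : d ≤ 1 := exp_le_one_iff.2 (by norm_num)
  have ha : 0 < c * d ^ s := mul_pos hc (rpow_pos_of_pos hd0 s)
  have hint := intervalIntegrable_weibullIntegrand hc hs ha
  have hsub : uIcc d 1 ⊆ uIcc 0 1 := by
    rw [uIcc_of_le hd1, uIcc_of_le zero_le_one]
    exact Icc_subset_Icc_left hd0.le
  have hinv : IntervalIntegrable (fun u : ℝ => 2⁻¹ * u⁻¹) volume d 1 :=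
    (intervalIntegrable_inv_iff.2 (Or.inr (by
      rw [uIcc_of_le hd1]; exact fun h => absurd h.1 hd0.not_ge))).const_mul _
  calc (1 : ℝ) = ∫ u in d..1, 2⁻¹ * u⁻¹ := by
        rw [intervalIntegral.integral_const_mul, integral_inv_of_pos hd0 one_pos, one_div,
          log_inv, hd, log_exp]
        norm_num
    _ ≤ ∫ u in d..1, weibullIntegrand c s (c * d ^ s) u := by
        refine intervalIntegral.integral_mono_on hd1 hinv (hint.mono_set hsub) fun u hu => ?_
        have hu0 : 0 < u := hd0.trans_le hu.1
        have hus : d ^ s ≤ u ^ s := rpow_le_rpow hd0.le hu.1 hs.le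
        have h1u : (1 - u) ^ s ≤ 1 := rpow_le_one (by linarith [hu.2]) (by linarith) hs.le
        have hden := weibullIntegrand_denom_pos hc hs ha ⟨hu0.le, hu.2⟩
        have hle : c * d ^ s * (1 - u) ^ s ≤ c * u ^ s :=
          (mul_le_of_le_one_right ha.le h1u).trans (by gcongr)
        rw [weibullIntegrand, le_div_iff₀ hden, rpow_sub_one hu0.ne']
        calc 2⁻¹ * u⁻¹ * (c * d ^ s * (1 - u) ^ s + c * u ^ s)
            ≤ 2⁻¹ * u⁻¹ * (c * u ^ s + c * u ^ s) := by gcongr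
          _ = c * (u ^ s / u) := by ring
    _ ≤ ∫ u in (0 : ℝ)..1, weibullIntegrand c s (c * d ^ s) u := by
        refine intervalIntegral.integral_mono_interval hd0.le hd1 le_rfl ?_ hint
        refine (ae_restrict_iff' measurableSet_Ioc).2 (ae_of_all _ fun u hu => ?_)
        exact weibullIntegrand_nonneg hc hs ha (Ioc_subset_Icc_self hu)

lemma exists_integral_weibullIntegrand_eq_one (hc : 0 < c) (hs : 0 < s) :
    ∃ a, 0 < a ∧ ∫ u in (0 : ℝ)..1, weibullIntegrand c s a u = 1 := by
  have ha : 0 < c * exp (-2) ^ s := mul_pos hc (rpow_pos_of_pos (exp_pos _) s)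
  obtain ⟨b, hb0, hb⟩ := ((Filter.eventually_gt_atTop 0).and
    ((tendsto_integral_weibullIntegrand_atTop hc hs).eventually_le_const one_pos)).exists
  obtain ⟨a, ha, h⟩ := isPreconnected_Ioi.intermediate_value (mem_Ioi.2 hb0) (mem_Ioi.2 ha)
    (continuousOn_integral_weibullIntegrand hc hs) ⟨hb, one_le_integral_weibullIntegrand hc hs⟩
  exact ⟨a, ha, h⟩

end weibullIntegrand

/-- Example 5: the function `m(ψ₀) = ∫₀¹ ψ* u^{ς-1}/(ψ₀^ς (1-u)^ς + ψ* u^ς) du`, which is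
`E[-log U(ψ₀)]` for the Weibull-ratio statistic, is strictly decreasing on `(0,∞)` and there
is a unique `ψ₀ > 0` with `m(ψ₀) = 1`. -/
theorem weibull_expectation_strictly_decreasing_unique_root
    (ψstar ς : ℝ) (hψstar : 0 < ψstar) (hς : 0 < ς)
    (m : ℝ → ℝ)
    (hm : ∀ ψ₀ : ℝ, m ψ₀ = ∫ u in (0 : ℝ)..1,
      ψstar * u ^ (ς - 1) / (ψ₀ ^ ς * (1 - u) ^ ς + ψstar * u ^ ς)) :
    StrictAntiOn m (Ioi (0 : ℝ)) ∧ ∃! ψ₀ : ℝ, 0 < ψ₀ ∧ m ψ₀ = 1 := by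
  have hmono : StrictAntiOn m (Ioi (0 : ℝ)) := by
    intro x hx y hy hxy
    rw [hm x, hm y]
    exact strictAntiOn_integral_weibullIntegrand hψstar hς (mem_Ioi.2 (rpow_pos_of_pos hx ς))
      (mem_Ioi.2 (rpow_pos_of_pos hy ς)) (rpow_lt_rpow (le_of_lt hx) hxy hς)
  refine ⟨hmono, ?_⟩
  obtain ⟨a, ha, h⟩ := exists_integral_weibullIntegrand_eq_one hψstar hς
  have hroot : 0 < a ^ ς⁻¹ ∧ m (a ^ ς⁻¹) = 1 := by
    refine ⟨rpow_pos_of_pos ha _, ?_⟩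
    rw [hm, rpow_inv_rpow ha.le hς.ne']
    exact h
  exact ⟨_, hroot, fun y hy => hmono.injOn hy.1 hroot.1 (hy.2.trans hroot.2.symm)⟩
end

section
/- Let η > 0 with η ≠ 1, and let U be a real random variable with cumulative distribution function F(u) = ηu/(1 − u + ηu) for 0 ≤ u ≤ 1 (equivalently, with density u ↦ η/(1 − u + ηu)² on (0,1)). Then E[−log U] = η log η/(η − 1). When η = 1, U is uniform on [0,1] and E[−log U] = 1. -/
open MeasureTheory Set Real ProbabilityTheory

section RatioCdf

variable {Ω : Type*} [MeasurableSpace Ω] {P : Measure Ω} [IsProbabilityMeasure P]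
  {η : ℝ} {U : Ω → ℝ}

lemma ae_pos_of_ratio_cdf
    (hcdf : ∀ u : ℝ, 0 ≤ u → u ≤ 1 →
      (P {ω | U ω ≤ u}).toReal = η * u / (1 - u + η * u)) :
    ∀ᵐ ω ∂P, 0 < U ω := by
  have h := hcdf 0 le_rfl zero_le_one
  rw [mul_zero, zero_div, ENNReal.toReal_eq_zero_iff, or_iff_left (measure_ne_top P _)] at h
  simpa [ae_iff] using h

lemma ae_le_one_of_ratio_cdf (hη : 0 < η) (hU : Measurable U)
    (hcdf : ∀ u : ℝ, 0 ≤ u → u ≤ 1 →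
      (P {ω | U ω ≤ u}).toReal = η * u / (1 - u + η * u)) :
    ∀ᵐ ω ∂P, U ω ≤ 1 := by
  have h := hcdf 1 zero_le_one le_rfl
  rw [sub_self, zero_add, mul_one, div_self hη.ne', ENNReal.toReal_eq_one_iff] at h
  exact (mem_ae_iff_prob_eq_one (measurableSet_le hU measurable_const)).2 h

lemma integral_neg_log_eq_of_ratio_cdf (hη : 0 < η) (hU : Measurable U)
    (hcdf : ∀ u : ℝ, 0 ≤ u → u ≤ 1 →
      (P {ω | U ω ≤ u}).toReal = η * u / (1 - u + η * u)) :
    ∫ ω, -log (U ω) ∂P =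
      ∫ t in Ioi (0 : ℝ), η * exp (-t) / (1 - exp (-t) + η * exp (-t)) := by
  have hpos := ae_pos_of_ratio_cdf hcdf
  have hnonneg : 0 ≤ᵐ[P] fun ω => -log (U ω) := by
    filter_upwards [hpos, ae_le_one_of_ratio_cdf hη hU hcdf] with ω h0 h1
    exact neg_nonneg.2 (log_nonpos h0.le h1)
  have hmeas : Measurable fun ω => -log (U ω) := (measurable_log.comp hU).neg
  rw [integral_eq_lintegral_of_nonneg_ae hnonneg hmeas.aestronglyMeasurable,
    lintegral_eq_lintegral_meas_le P hnonneg hmeas.aemeasurable,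
    integral_eq_lintegral_of_nonneg_ae]
  · congr 1
    refine setLIntegral_congr_fun measurableSet_Ioi fun t ht => ?_
    have hle : exp (-t) ≤ 1 := exp_le_one_iff.2 (neg_nonpos.2 (mem_Ioi.1 ht).le)
    rw [← hcdf _ (exp_pos _).le hle, ENNReal.ofReal_toReal (measure_ne_top P _)]
    refine measure_congr ?_
    filter_upwards [hpos] with ω h0
    refine propext ?_
    change t ≤ -log (U ω) ↔ U ω ≤ exp (-t)
    rw [← log_le_iff_le_exp h0, le_neg]
  · filter_upwards [ae_restrict_mem measurableSet_Ioi] with t ht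
    have hle : exp (-t) ≤ 1 := exp_le_one_iff.2 (neg_nonpos.2 (mem_Ioi.1 ht).le)
    have h := exp_pos (-t)
    have hd : 0 ≤ 1 - exp (-t) := sub_nonneg.2 hle
    simp only [Pi.zero_apply]
    positivity
  · exact Measurable.aestronglyMeasurable (by fun_prop)

lemma integral_ratio_exp_neg (hη : 0 < η) (hne : η ≠ 1) :
    ∫ t in Ioi (0 : ℝ), η * exp (-t) / (1 - exp (-t) + η * exp (-t)) =
      η * log η / (η - 1) := by
  have hsub : η - 1 ≠ 0 := sub_ne_zero.2 hne
  have hden : ∀ t : ℝ, 0 ≤ t → 0 < 1 - exp (-t) + η * exp (-t) := fun t ht => by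
    have hle : exp (-t) ≤ 1 := exp_le_one_iff.2 (neg_nonpos.2 ht)
    have := mul_pos hη (exp_pos (-t))
    linarith
  have hderiv : ∀ t ∈ Ici (0 : ℝ),
      HasDerivAt (fun t => -(η / (η - 1)) * log (1 - exp (-t) + η * exp (-t)))
        (η * exp (-t) / (1 - exp (-t) + η * exp (-t))) t := fun t ht => by
    have hd := (hden t ht).ne'
    have he : HasDerivAt (fun t : ℝ => exp (-t)) (exp (-t) * -1) t := (hasDerivAt_neg t).exp
    have h := (((he.const_sub 1).add (he.const_mul η)).log hd).const_mul (-(η / (η - 1)))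
    refine h.congr_deriv ?_
    simp only [Pi.add_apply]
    field_simp
    ring
  have hlim : Filter.Tendsto
      (fun t : ℝ => -(η / (η - 1)) * log (1 - exp (-t) + η * exp (-t)))
      Filter.atTop (nhds 0) := by
    have he := tendsto_exp_neg_atTop_nhds_zero
    have hd : Filter.Tendsto (fun t : ℝ => 1 - exp (-t) + η * exp (-t))
        Filter.atTop (nhds 1) := by
      simpa using (he.const_sub 1).add (he.const_mul η)
    simpa using (hd.log one_ne_zero).const_mul (-(η / (η - 1)))
  rw [integral_Ioi_of_hasDerivAt_of_nonneg' hderiv (fun t ht => ?_) hlim]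
  · simp
    ring
  · exact div_nonneg (mul_pos hη (exp_pos _)).le (hden t (mem_Ioi.1 ht).le).le

lemma map_eq_uniform_of_cdf (hU : Measurable U)
    (hcdf : ∀ u : ℝ, 0 ≤ u → u ≤ 1 → (P {ω | U ω ≤ u}).toReal = u) :
    Measure.map U P = volume.restrict (Icc (0 : ℝ) 1) := by
  have : IsProbabilityMeasure (Measure.map U P) := Measure.isProbabilityMeasure_map hU.aemeasurable
  have hval : ∀ u : ℝ, 0 ≤ u → u ≤ 1 → P {ω | U ω ≤ u} = ENNReal.ofReal u := fun u h0 h1 => by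
    rw [← ENNReal.ofReal_toReal (measure_ne_top P {ω | U ω ≤ u}), hcdf u h0 h1]
  refine Measure.ext_of_Iic _ _ fun u => ?_
  rw [Measure.map_apply hU measurableSet_Iic, Measure.restrict_apply measurableSet_Iic,
    inter_comm,
    ← Ici_inter_Iic, inter_assoc, Iic_inter_Iic, Ici_inter_Iic, volume_Icc, sub_zero]
  change P {ω | U ω ≤ u} = _
  rcases lt_or_ge u 0 with h0 | h0
  · rw [ENNReal.ofReal_of_nonpos ((min_le_right _ _).trans h0.le)]
    refine measure_mono_null (fun ω (hω : U ω ≤ u) => hω.trans h0.le) ?_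
    exact (hval 0 le_rfl zero_le_one).trans ENNReal.ofReal_zero
  rcases le_or_gt u 1 with h1 | h1
  · rw [min_eq_right h1, hval u h0 h1]
  · rw [min_eq_left h1.le, ENNReal.ofReal_one]
    refine le_antisymm prob_le_one ?_
    calc (1 : ENNReal) = P {ω | U ω ≤ 1} := by rw [hval 1 zero_le_one le_rfl, ENNReal.ofReal_one]
      _ ≤ _ := measure_mono fun ω (hω : U ω ≤ 1) => hω.trans h1.le

end RatioCdf

/-- Example 6, closed-form expectation: if `U` has CDF `u ↦ ηu/(1-u+ηu)` on `[0,1]` with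
`η > 0`, then `E[-log U] = η log η/(η-1)` when `η ≠ 1`; when `η = 1`, `U` is uniform on
`[0,1]` and `E[-log U] = 1`. -/
theorem expectation_neg_log_ratio_cdf
    {Ω : Type*} [MeasurableSpace Ω] (P : Measure Ω) [IsProbabilityMeasure P]
    (η : ℝ) (hη : 0 < η)
    (U : Ω → ℝ) (hU : Measurable U)
    (hcdf : ∀ u : ℝ, 0 ≤ u → u ≤ 1 →
      (P {ω | U ω ≤ u}).toReal = η * u / (1 - u + η * u)) :
    (η ≠ 1 → ∫ ω, -Real.log (U ω) ∂P = η * Real.log η / (η - 1)) ∧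
      (η = 1 → Measure.map U P = volume.restrict (Icc (0 : ℝ) 1) ∧
        ∫ ω, -Real.log (U ω) ∂P = 1) := by
  refine ⟨fun hne => ?_, ?_⟩
  · rw [integral_neg_log_eq_of_ratio_cdf hη hU hcdf, integral_ratio_exp_neg hη hne]
  · rintro rfl
    refine ⟨map_eq_uniform_of_cdf hU fun u h0 h1 => by simpa using hcdf u h0 h1, ?_⟩
    rw [integral_neg_log_eq_of_ratio_cdf hη hU hcdf]
    simpa using integral_exp_neg_Ioi_zero
end

section
/- Define h : (0, ∞) → ℝ by h(η) = η log η/(η − 1) for η ≠ 1 and h(1) = 1. Then h is continuous and strictly increasing on (0, ∞); in particular h(η) < 1 for 0 < η < 1, h(1) = 1, and h(η) > 1 for η > 1, so h(η) = 1 if and only if η = 1. -/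
open Set Real

theorem sub_one_lt_mul_log {x : ℝ} (hx : 0 < x) (hx1 : x ≠ 1) : x - 1 < x * Real.log x := by
  have hlog := Real.log_lt_sub_one_of_pos (inv_pos.2 hx) (by simpa using hx1)
  rw [Real.log_inv] at hlog
  have hmul := mul_lt_mul_of_pos_left hlog hx
  rw [mul_sub, mul_inv_cancel₀ hx.ne'] at hmul
  linarith

theorem continuousOn_dslope_mul_log :
    ContinuousOn (dslope (fun x : ℝ => x * Real.log x) 1) (Ioi 0) :=
  (continuousOn_dslope (Ioi_mem_nhds one_pos)).2
    ⟨Real.continuous_mul_log.continuousOn,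
      (Real.hasDerivAt_mul_log one_ne_zero).differentiableAt⟩

/-- Example 6, monotonicity-and-crossing: the function `h(η) = η log η/(η-1)` extended by
`h(1) = 1` is continuous and strictly increasing on `(0,∞)`; in particular `h(η) < 1` for
`0 < η < 1`, `h(1) = 1`, `h(η) > 1` for `η > 1`, and `h(η) = 1` iff `η = 1`. -/
theorem eta_log_eta_monotone
    (h : ℝ → ℝ)
    (hdef : ∀ η : ℝ, η ≠ 1 → h η = η * Real.log η / (η - 1))
    (hone : h 1 = 1) :
    ContinuousOn h (Ioi (0 : ℝ)) ∧
      StrictMonoOn h (Ioi (0 : ℝ)) ∧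
      (∀ η : ℝ, 0 < η → η < 1 → h η < 1) ∧
      (∀ η : ℝ, 1 < η → 1 < h η) ∧
      (∀ η : ℝ, 0 < η → (h η = 1 ↔ η = 1)) := by
  have h_eq : h = dslope (fun x : ℝ => x * Real.log x) 1 := by
    funext x
    rcases eq_or_ne x 1 with rfl | hx
    · rw [dslope_same, (Real.hasDerivAt_mul_log one_ne_zero).deriv, hone]
      simp
    · rw [dslope_of_ne _ hx, hdef x hx, slope_def_field]
      simp
  have hlt : ∀ η : ℝ, 0 < η → η < 1 → h η < 1 := fun η h0 h1 => by
    rw [hdef η h1.ne, div_lt_one_of_neg (sub_neg.2 h1)]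
    exact sub_one_lt_mul_log h0 h1.ne
  have hgt : ∀ η : ℝ, 1 < η → 1 < h η := fun η h1 => by
    rw [hdef η h1.ne', one_lt_div (sub_pos.2 h1)]
    exact sub_one_lt_mul_log (one_pos.trans h1) h1.ne'
  refine ⟨h_eq ▸ continuousOn_dslope_mul_log, ?_, hlt, hgt, fun η h0 => ⟨fun heq => ?_, ?_⟩⟩
  · intro x hx y hy hxy
    rcases eq_or_ne x 1 with rfl | hx1
    · exact hone.symm ▸ hgt y hxy
    rcases eq_or_ne y 1 with rfl | hy1
    · exact hone.symm ▸ hlt x hx hxy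
    have hsecant := Real.strictConvexOn_mul_log.secant_strict_mono (a := 1)
      (mem_Ici.2 zero_le_one) (Ioi_subset_Ici_self hx) (Ioi_subset_Ici_self hy) hx1 hy1 hxy
    simpa [hdef x hx1, hdef y hy1] using hsecant
  · rcases lt_trichotomy η 1 with h1 | h1 | h1
    · exact absurd heq (hlt η h0 h1).ne
    · exact h1
    · exact absurd heq (hgt η h1).ne'
  · rintro rfl
    exact hone
end
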